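/- arXiv:math/9706223 — 2 statements merged into one kernel-verified Lean document; each statement's English description precedes it below -/
import Mathlib

section
/- Let χ be an infinite cardinal and λ = χ⁺, and let H₀, H₁ : λ × λ → λ witness λ = χ⁺. Suppose a, b ⊆ λ are H-closed sets with a ∩ χ = b ∩ χ. Then a ∩ b is an initial segment of a and an initial segment of b (that is: if γ ∈ a ∩ b and δ ∈ a with δ < γ, then δ ∈ b, and symmetrically). Moreover, if a and b have the same order type, then the unique order-preserving bijection from a onto b is the identity on a ∩ b. -/
open Set

noncomputable section

/-- The order type of a set of ordinals: the unique ordinal `o` such that the increasing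
enumeration of `Iio o` maps onto `s` (junk value `0` if no such ordinal exists). -/
def otp (s : Set Ordinal) : Ordinal :=
  sInf {o : Ordinal | ∃ f : Ordinal → Ordinal, StrictMonoOn f (Set.Iio o) ∧ f '' Set.Iio o = s}

/-- `H₀, H₁` witness `lam = χ⁺`: for `χ ≤ α < lam`, `H₀(α, ·)` is a bijection from `α`
onto `χ` and `H₁(α, H₀(α, i)) = i` for all `i < α`. -/
def IsWitness (χ : Cardinal) (lam : Ordinal) (H0 H1 : Ordinal → Ordinal → Ordinal) : Prop :=
  ∀ α, χ.ord ≤ α → α < lam →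
    Set.BijOn (H0 α) (Set.Iio α) (Set.Iio χ.ord) ∧ ∀ i < α, H1 α (H0 α i) = i

/-- `a` is closed under the witnessing functions `H₀, H₁`. -/
def HClosed (χ : Cardinal) (H0 H1 : Ordinal → Ordinal → Ordinal) (a : Set Ordinal) : Prop :=
  (∀ β ∈ a, ∀ γ ∈ a, χ.ord ≤ β → γ < β → H0 β γ ∈ a) ∧
  (∀ β ∈ a, ∀ i ∈ a, χ.ord ≤ β → i < χ.ord → H1 β i ∈ a)

/-- Below a common element, an `H`-closed set lies inside any `H`-closed set containing the same
ordinals below `χ`. -/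
theorem HClosed.mem_of_lt_of_mem_inter {χ : Cardinal} {lam : Ordinal}
    {H0 H1 : Ordinal → Ordinal → Ordinal} {a b : Set Ordinal}
    (hH : IsWitness χ lam H0 H1) (ha : a ⊆ Set.Iio lam)
    (hac : HClosed χ H0 H1 a) (hbc : HClosed χ H0 H1 b)
    (hab : a ∩ Set.Iio χ.ord ⊆ b) {γ δ : Ordinal} (hγ : γ ∈ a ∩ b) (hδ : δ ∈ a)
    (hlt : δ < γ) : δ ∈ b := by
  rcases lt_or_ge δ χ.ord with hδχ | hδχ
  · exact hab ⟨hδ, hδχ⟩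
  · have hγχ : χ.ord ≤ γ := hδχ.trans hlt.le
    obtain ⟨hbij, hinv⟩ := hH γ hγχ (ha hγ.1)
    have hi : H0 γ δ < χ.ord := hbij.mapsTo hlt
    have hib : H0 γ δ ∈ b := hab ⟨hac.1 γ hγ.1 δ hδ hγχ hlt, hi⟩
    simpa only [hinv δ hlt] using hbc.2 γ hγ.2 _ hib hγχ hi

/-- A strictly monotone bijection between two sets whose intersection is an initial segment of
both is the identity on the intersection. -/
theorem StrictMonoOn.eq_self_of_mem_inter {α : Type*} [LinearOrder α] [WellFoundedLT α]
    {a b : Set α} {g : α → α} (hg : StrictMonoOn g a) (hbij : Set.BijOn g a b)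
    (hab : ∀ γ ∈ a ∩ b, ∀ δ ∈ a, δ < γ → δ ∈ b)
    (hba : ∀ γ ∈ a ∩ b, ∀ δ ∈ b, δ < γ → δ ∈ a) {x : α} (hx : x ∈ a ∩ b) : g x = x := by
  induction x using WellFoundedLT.induction with
  | ind x ih =>
    rcases lt_trichotomy (g x) x with h | h | h
    · have hgb : g x ∈ b := hbij.mapsTo hx.1
      have hga : g x ∈ a := hba x hx _ hgb h
      exact hbij.injOn hga hx.1 (ih _ h ⟨hga, hgb⟩)
    · exact h
    · obtain ⟨y, hy, rfl⟩ := hbij.surjOn hx.2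
      have hlt : y < g y := (hg.lt_iff_lt hy hx.1).1 h
      exact congrArg g (ih y hlt ⟨hy, hab _ hx y hy hlt⟩)

/-- If `a, b ⊆ λ = χ⁺` are `H`-closed sets with `a ∩ χ = b ∩ χ`, then `a ∩ b` is an initial
segment of both `a` and `b`; moreover if `a` and `b` have the same order type, the unique
order-preserving bijection from `a` onto `b` is the identity on `a ∩ b`. -/
theorem hclosed_inter_initialSegment
    (χ : Cardinal) (hχ : Cardinal.aleph0 ≤ χ)
    (H0 H1 : Ordinal → Ordinal → Ordinal)
    (hH : IsWitness χ (Order.succ χ).ord H0 H1)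
    (a b : Set Ordinal)
    (ha : a ⊆ Set.Iio (Order.succ χ).ord) (hb : b ⊆ Set.Iio (Order.succ χ).ord)
    (hac : HClosed χ H0 H1 a) (hbc : HClosed χ H0 H1 b)
    (hab : a ∩ Set.Iio χ.ord = b ∩ Set.Iio χ.ord) :
    (∀ γ ∈ a ∩ b, ∀ δ ∈ a, δ < γ → δ ∈ b) ∧
    (∀ γ ∈ a ∩ b, ∀ δ ∈ b, δ < γ → δ ∈ a) ∧
    (otp a = otp b →
      ∀ g : Ordinal → Ordinal, Set.BijOn g a b → StrictMonoOn g a →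
        ∀ x ∈ a ∩ b, g x = x) := by
  have hinit : ∀ γ ∈ a ∩ b, ∀ δ ∈ a, δ < γ → δ ∈ b := fun γ hγ δ hδ hlt =>
    hac.mem_of_lt_of_mem_inter hH ha hbc (fun x hx => (hab.subset hx).1) hγ hδ hlt
  have hinit' : ∀ γ ∈ a ∩ b, ∀ δ ∈ b, δ < γ → δ ∈ a := fun γ hγ δ hδ hlt =>
    hbc.mem_of_lt_of_mem_inter hH hb hac (fun x hx => (hab.superset hx).1) hγ.symm hδ hlt
  exact ⟨hinit, hinit', fun _ g hbij hg x hx => hg.eq_self_of_mem_inter hbij hinit hinit' hx⟩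

end
end

section
/- Let χ be an infinite cardinal, λ = χ⁺, and let H₀, H₁ : λ × λ → λ witness λ = χ⁺. Let a, b ⊆ λ be H-closed sets with a ∩ χ = b ∩ χ, both of order type ξ, with order isomorphisms g_a : ξ → a and g_b : ξ → b, and set h = g_b ∘ g_a⁻¹ : a → b. Let B̄ ⊆ ξ and let ⟨N_s : s ∈ [B̄]^{≤2}⟩ be a family of subsets of ξ. For u ∈ [g_a''B̄]^{≤2} define M^a_u = g_a''(N_{g_a⁻¹''u}), and analogously define M^b_v for v ∈ [g_b''B̄]^{≤2}. Then h restricted to ⋃{M^a_u} is an order-preserving bijection onto ⋃{M^b_v}, it maps g_a''B̄ onto g_b''B̄ and each M^a_u onto M^b_{h''u}, it is the identity on (⋃{M^a_u}) ∩ (⋃{M^b_v}), and this intersection is an initial segment of both ⋃{M^a_u} and ⋃{M^b_v}. -/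
open Set

noncomputable section

/-- `s` is a subset of `B̄` (a set of ordinals) of size at most 2. -/
def InSubTwo (B : Set Ordinal) (s : Finset Ordinal) : Prop :=
  ↑s ⊆ B ∧ s.card ≤ 2

/-- Below a common element, an `H`-closed set is contained in any `H`-closed set with the same
trace on `χ`. -/
theorem HClosed.mem_of_lt {χ : Cardinal} {lam : Ordinal} {H0 H1 : Ordinal → Ordinal → Ordinal}
    (hH : IsWitness χ lam H0 H1) {a b : Set Ordinal} (ha : a ⊆ Set.Iio lam)
    (hac : HClosed χ H0 H1 a) (hbc : HClosed χ H0 H1 b)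
    (hab : a ∩ Set.Iio χ.ord = b ∩ Set.Iio χ.ord)
    {x y : Ordinal} (hxa : x ∈ a) (hxb : x ∈ b) (hya : y ∈ a) (hyx : y < x) : y ∈ b := by
  rcases lt_or_ge x χ.ord with hx | hx
  · exact (hab.subset ⟨hya, hyx.trans hx⟩).1
  · obtain ⟨hbij, hinv⟩ := hH x hx (ha hxa)
    have hlt : H0 x y < χ.ord := hbij.mapsTo hyx
    have hmem : H0 x y ∈ b := (hab.subset ⟨hac.1 x hxa y hya hx hyx, hlt⟩).1
    exact hinv y hyx ▸ hbc.2 x hxb _ hmem hx hlt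

/-- Two strictly monotone enumerations of sets which agree below each of their common elements
list every common element at the same index. -/
theorem StrictMonoOn.index_eq_of_agree_below {α β : Type*} [LinearOrder α] [WellFoundedLT α]
    [LinearOrder β] {ξ : α} {f g : α → β}
    (hf : StrictMonoOn f (Set.Iio ξ)) (hg : StrictMonoOn g (Set.Iio ξ))
    (hfg : ∀ x ∈ f '' Set.Iio ξ, x ∈ g '' Set.Iio ξ →
      ∀ y < x, y ∈ f '' Set.Iio ξ ↔ y ∈ g '' Set.Iio ξ)
    {i j : α} (hi : i < ξ) (hj : j < ξ) (hij : f i = g j) : i = j := by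
  induction i using WellFoundedLT.induction generalizing j with
  | ind i ih =>
    have key := hfg (f i) ⟨i, hi, rfl⟩ ⟨j, hj, hij.symm⟩
    rcases lt_trichotomy i j with hlt | heq | hlt
    · have hgi : g i < f i := hij ▸ hg hi hj hlt
      obtain ⟨k, hk, hki⟩ := (key _ hgi).2 ⟨i, hi, rfl⟩
      have hlt' : k < i := (hf.lt_iff_lt hk hi).1 (hki ▸ hgi)
      exact absurd (ih k hlt' hk hi hki) hlt'.ne
    · exact heq
    · have hfj : f j < f i := hf hj hi hlt
      obtain ⟨k, hk, hkj⟩ := (key _ hfj).1 ⟨j, hj, rfl⟩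
      have hlt' : k < j := (hg.lt_iff_lt hk hj).1 (by rw [hkj, ← hij]; exact hfj)
      exact absurd (ih j hlt hj hk hkj.symm) hlt'.ne'

/-- Two systems transported from a common blueprint `⟨N_s : s ∈ [B̄]^{≤2}⟩` on `ξ` to
order-isomorphic `H`-closed sets `a, b` are related by the order isomorphism
`h = g_b ∘ g_a⁻¹`, which fixes their common part; the common part is an initial segment
of both unions. -/
theorem transported_systems
    (χ : Cardinal) (hχ : Cardinal.aleph0 ≤ χ)
    (H0 H1 : Ordinal → Ordinal → Ordinal)
    (hH : IsWitness χ (Order.succ χ).ord H0 H1)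
    (a b : Set Ordinal)
    (ha : a ⊆ Set.Iio (Order.succ χ).ord) (hb : b ⊆ Set.Iio (Order.succ χ).ord)
    (hac : HClosed χ H0 H1 a) (hbc : HClosed χ H0 H1 b)
    (hab : a ∩ Set.Iio χ.ord = b ∩ Set.Iio χ.ord)
    (ξ : Ordinal) (ga gb : Ordinal → Ordinal)
    (hga_mono : StrictMonoOn ga (Set.Iio ξ)) (hga_onto : ga '' Set.Iio ξ = a)
    (hgb_mono : StrictMonoOn gb (Set.Iio ξ)) (hgb_onto : gb '' Set.Iio ξ = b)
    (h : Ordinal → Ordinal) (hh : ∀ x < ξ, h (ga x) = gb x)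
    (Bbar : Set Ordinal) (hBbar : Bbar ⊆ Set.Iio ξ)
    (N : Finset Ordinal → Set Ordinal)
    (hN : ∀ s, InSubTwo Bbar s → N s ⊆ Set.Iio ξ) :
    -- the unions of the two transported systems:
    Set.BijOn h (⋃ s ∈ {s : Finset Ordinal | InSubTwo Bbar s}, ga '' N s)
      (⋃ s ∈ {s : Finset Ordinal | InSubTwo Bbar s}, gb '' N s) ∧
    StrictMonoOn h (⋃ s ∈ {s : Finset Ordinal | InSubTwo Bbar s}, ga '' N s) ∧
    h '' (ga '' Bbar) = gb '' Bbar ∧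
    (∀ s, InSubTwo Bbar s → h '' (ga '' N s) = gb '' N s) ∧
    (∀ x ∈ (⋃ s ∈ {s : Finset Ordinal | InSubTwo Bbar s}, ga '' N s) ∩
        (⋃ s ∈ {s : Finset Ordinal | InSubTwo Bbar s}, gb '' N s), h x = x) ∧
    (∀ x ∈ (⋃ s ∈ {s : Finset Ordinal | InSubTwo Bbar s}, ga '' N s) ∩
        (⋃ s ∈ {s : Finset Ordinal | InSubTwo Bbar s}, gb '' N s),
      ∀ y ∈ (⋃ s ∈ {s : Finset Ordinal | InSubTwo Bbar s}, ga '' N s), y < x →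
        y ∈ (⋃ s ∈ {s : Finset Ordinal | InSubTwo Bbar s}, gb '' N s)) ∧
    (∀ x ∈ (⋃ s ∈ {s : Finset Ordinal | InSubTwo Bbar s}, ga '' N s) ∩
        (⋃ s ∈ {s : Finset Ordinal | InSubTwo Bbar s}, gb '' N s),
      ∀ y ∈ (⋃ s ∈ {s : Finset Ordinal | InSubTwo Bbar s}, gb '' N s), y < x →
        y ∈ (⋃ s ∈ {s : Finset Ordinal | InSubTwo Bbar s}, ga '' N s)) := by
  subst hga_onto hgb_onto
  have hagree : ∀ x ∈ ga '' Set.Iio ξ, x ∈ gb '' Set.Iio ξ →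
      ∀ y < x, y ∈ ga '' Set.Iio ξ ↔ y ∈ gb '' Set.Iio ξ := fun x hxa hxb y hyx =>
    ⟨fun hy => hac.mem_of_lt hH ha hbc hab hxa hxb hy hyx,
      fun hy => hbc.mem_of_lt hH hb hac hab.symm hxb hxa hy hyx⟩
  have hindex : ∀ {i j}, i < ξ → j < ξ → ga i = gb j → i = j :=
    hga_mono.index_eq_of_agree_below hgb_mono hagree
  have himage : ∀ S ⊆ Set.Iio ξ, h '' (ga '' S) = gb '' S := fun S hS => by
    rw [Set.image_image]
    exact Set.image_congr fun x hx => hh x (hS hx)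
  simp only [← Set.image_iUnion₂]
  set U := ⋃ s ∈ {s : Finset Ordinal | InSubTwo Bbar s}, N s
  have hU : U ⊆ Set.Iio ξ := Set.iUnion₂_subset hN
  have hmono : StrictMonoOn h (ga '' U) := by
    rintro _ ⟨i, hi, rfl⟩ _ ⟨j, hj, rfl⟩ hij
    rw [hh i (hU hi), hh j (hU hj)]
    exact hgb_mono (hU hi) (hU hj) ((hga_mono.lt_iff_lt (hU hi) (hU hj)).1 hij)
  refine ⟨himage U hU ▸ hmono.injOn.bijOn_image, hmono, himage Bbar hBbar,
    fun s hs => himage (N s) (hN s hs), ?_, ?_, ?_⟩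
  · rintro _ ⟨⟨i, hi, rfl⟩, j, hj, hji⟩
    obtain rfl := hindex (hU hi) (hU hj) hji.symm
    rw [hh i (hU hi), hji]
  · rintro x ⟨hxa, hxb⟩ _ ⟨j, hj, rfl⟩ hjx
    obtain ⟨k, hk, hkj⟩ := (hagree x (Set.image_mono hU hxa) (Set.image_mono hU hxb) _ hjx).1
      ⟨j, hU hj, rfl⟩
    obtain rfl := hindex (hU hj) hk hkj.symm
    exact ⟨j, hj, hkj⟩
  · rintro x ⟨hxa, hxb⟩ _ ⟨j, hj, rfl⟩ hjx
    obtain ⟨k, hk, hkj⟩ := (hagree x (Set.image_mono hU hxa) (Set.image_mono hU hxb) _ hjx).2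
      ⟨j, hU hj, rfl⟩
    obtain rfl := hindex hk (hU hj) hkj
    exact ⟨k, hj, hkj⟩

end
end
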